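/- Let n ≥ 2, l ≥ 0 and m ≥ 0 be integers with 2m+1 < n. Then for every real r, [Γ(m+1)Γ(l+(n+1)/2+m)/(Γ(2m+1)Γ(l+(n+1)/2))] · F(l+(n−1)/2−m, −m; l+(n+1)/2; r) = Σ_{k=0}^{m} [(l+(n−1)/2−m)_k (−m)_k / ((−2m)_k k!)] (1−r)^k (both sides are polynomials of degree m in r, since the hypergeometric series terminates). -/

import Mathlib

open Real Filter
open scoped Real BigOperators Nat Topology

noncomputable section

/-- Pochhammer symbol `(a)_k`. -/
def poch (a : ℝ) (k : ℕ) : ℝ := (ascPochhammer ℝ k).eval a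

/-- Gauss hypergeometric function `F(a,b;c;z)`. -/
def hyperF (a b c z : ℝ) : ℝ :=
  ∑' k : ℕ, poch a k * poch b k / (poch c k * (k : ℕ)!) * z ^ k


lemma poch_zero (a : ℝ) : poch a 0 = 1 := by simp [poch]

lemma poch_succ (a : ℝ) (k : ℕ) : poch a (k + 1) = poch a k * (a + k) := by
  simp [poch, ascPochhammer_succ_eval]

lemma poch_succ_left (a : ℝ) (k : ℕ) : poch a (k + 1) = a * poch (a + 1) k := by
  simp [poch, ascPochhammer_succ_left, Polynomial.eval_comp]

lemma poch_add (a : ℝ) (j k : ℕ) : poch a (j + k) = poch a j * poch (a + j) k := by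
  induction k with
  | zero => simp [poch_zero]
  | succ k ih => rw [← add_assoc, poch_succ, ih, poch_succ]; push_cast; ring

lemma poch_pos (a : ℝ) (ha : 0 < a) (k : ℕ) : 0 < poch a k := ascPochhammer_pos k a ha

lemma pascal_sum (m : ℕ) (g : ℕ → ℝ) :
    ∑ k ∈ Finset.range (m + 2), ((m + 1).choose k : ℝ) * g k =
      ∑ k ∈ Finset.range (m + 1), (m.choose k : ℝ) * (g k + g (k + 1)) := by
  rw [Finset.sum_range_succ']
  simp only [Nat.choose_succ_succ, Nat.cast_add, add_mul, mul_add, Finset.sum_add_distrib]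
  have h : ∑ k ∈ Finset.range (m + 1), (m.choose k : ℝ) * g k
      = ∑ k ∈ Finset.range (m + 1), (m.choose (k + 1) : ℝ) * g (k + 1) + g 0 := by
    have h1 := Finset.sum_range_succ' (fun k => (m.choose k : ℝ) * g k) (m + 1)
    rw [Finset.sum_range_succ] at h1
    simpa using h1
  rw [h]
  simp
  ring

lemma key (m : ℕ) (r : ℝ) : ∀ a b : ℝ,
    ∑ k ∈ Finset.range (m + 1), (m.choose k : ℝ) * (poch a k * poch b (m - k) * (1 - r) ^ k) =
    ∑ k ∈ Finset.range (m + 1),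
      (m.choose k : ℝ) * (poch a k * poch (a + b + k) (m - k) * (-r) ^ k) := by
  induction m with
  | zero => intro a b; simp [poch_zero]
  | succ m ih =>
    intro a b
    rw [pascal_sum, pascal_sum]
    have h1 := ih (a + 1) b
    have h2 := ih a (b + 1)
    trans a * (1 - r) * (∑ k ∈ Finset.range (m + 1),
        (m.choose k : ℝ) * (poch (a + 1) k * poch b (m - k) * (1 - r) ^ k)) +
      b * (∑ k ∈ Finset.range (m + 1),
        (m.choose k : ℝ) * (poch a k * poch (b + 1) (m - k) * (1 - r) ^ k))
    · rw [Finset.mul_sum, Finset.mul_sum, ← Finset.sum_add_distrib]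
      refine Finset.sum_congr rfl fun k hk => ?_
      have hk' : k ≤ m := Nat.lt_succ_iff.mp (Finset.mem_range.mp hk)
      rw [Nat.succ_sub hk', poch_succ_left b, Nat.add_sub_add_right, poch_succ_left a]
      ring
    · rw [h1, h2, Finset.mul_sum, Finset.mul_sum, ← Finset.sum_add_distrib]
      refine Finset.sum_congr rfl fun k hk => ?_
      have hk' : k ≤ m := Nat.lt_succ_iff.mp (Finset.mem_range.mp hk)
      rw [Nat.succ_sub hk', poch_succ_left (a + b + k), Nat.add_sub_add_right]
      have e1 : a + 1 + b + (k : ℝ) = a + b + k + 1 := by ring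
      have e2 : a + (b + 1) + (k : ℝ) = a + b + k + 1 := by ring
      have e3 : a + b + ((k + 1 : ℕ) : ℝ) = a + b + k + 1 := by push_cast; ring
      have e4 : a * poch (a + 1) k = poch a k * (a + k) := by
        rw [← poch_succ_left, poch_succ]
      rw [e1, e2, e3, poch_succ a]
      generalize poch (a + b + k + 1) (m - k) = P
      linear_combination ((m.choose k : ℝ) * P * (1 - r) * (-r) ^ k) * e4

lemma poch_neg (M k : ℕ) (h : k ≤ M) :
    poch (-(M : ℝ)) k * ((M - k)! : ℝ) = (-1) ^ k * (M ! : ℝ) := by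
  induction k with
  | zero => simp [poch_zero]
  | succ k ih =>
    have ih := ih (by omega)
    obtain ⟨d, rfl⟩ := Nat.exists_eq_add_of_le h
    have e1 : k + 1 + d - k = d + 1 := by omega
    have e2 : k + 1 + d - (k + 1) = d := by omega
    rw [e1, Nat.factorial_succ] at ih
    rw [e2, poch_succ, pow_succ]
    push_cast at ih ⊢
    linear_combination (-1) * ih

lemma poch_neg_zero (M k : ℕ) (h : M < k) : poch (-(M : ℝ)) k = 0 := by
  obtain ⟨d, rfl⟩ := Nat.exists_eq_add_of_lt h
  rw [add_assoc, add_comm d 1, ← add_assoc, poch_add, poch_succ]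
  simp

lemma poch_nat (p k : ℕ) : (p ! : ℝ) * poch (p + 1) k = ((p + k)! : ℝ) := by
  induction k with
  | zero => simp [poch_zero]
  | succ k ih =>
    rw [← add_assoc, Nat.factorial_succ, poch_succ]
    push_cast
    linear_combination (p + 1 + k : ℝ) * ih

lemma Gamma_poch (c : ℝ) (hc : 0 < c) (k : ℕ) : Gamma (c + k) = Gamma c * poch c k := by
  induction k with
  | zero => simp [poch_zero]
  | succ k ih =>
    push_cast
    rw [← add_assoc, Gamma_add_one (by positivity), ih, poch_succ]
    ring

theorem terminating_hypergeometric_identity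
    (n l m : ℕ) (hn : 2 ≤ n) (hmn : 2 * m + 1 < n) (r : ℝ) :
    Gamma ((m : ℝ) + 1) * Gamma ((l : ℝ) + ((n : ℝ) + 1) / 2 + m) /
        (Gamma (2 * (m : ℝ) + 1) * Gamma ((l : ℝ) + ((n : ℝ) + 1) / 2)) *
      hyperF ((l : ℝ) + ((n : ℝ) - 1) / 2 - m) (-(m : ℝ)) ((l : ℝ) + ((n : ℝ) + 1) / 2) r =
    ∑ k ∈ Finset.range (m + 1),
      poch ((l : ℝ) + ((n : ℝ) - 1) / 2 - m) k * poch (-(m : ℝ)) k /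
        (poch (-(2 * (m : ℝ))) k * (k : ℕ)!) * (1 - r) ^ k := by
  obtain ⟨c, hc⟩ : ∃ c : ℝ, c = (l : ℝ) + ((n : ℝ) + 1) / 2 := ⟨_, rfl⟩
  have ha : (l : ℝ) + ((n : ℝ) - 1) / 2 - m = c - 1 - m := by rw [hc]; ring
  have hcpos : 0 < c := by rw [hc]; positivity
  rw [ha, ← hc, Gamma_poch c hcpos m, Gamma_nat_eq_factorial]
  have hG : Gamma (2 * (m : ℝ) + 1) = ((2 * m)! : ℝ) := by
    have := Gamma_nat_eq_factorial (2 * m)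
    push_cast at this
    exact this
  rw [hG]
  have hGc : Gamma c ≠ 0 := (Gamma_pos_of_pos hcpos).ne'
  have hF : (((2 * m)! : ℕ) : ℝ) ≠ 0 := by positivity
  obtain ⟨a, haa⟩ : ∃ a : ℝ, a = c - 1 - m := ⟨_, rfl⟩
  rw [← haa]
  have hk := key m r a (m + 1)
  have hc2 : a + ((m : ℝ) + 1) = c := by rw [haa]; ring
  rw [hc2] at hk
  unfold hyperF
  rw [tsum_eq_sum (s := Finset.range (m + 1))]
  swap
  · intro k hk
    rw [poch_neg_zero m k (by simpa using hk)]
    simp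
  trans (m ! : ℝ) / ((2 * m)! : ℕ) * ∑ k ∈ Finset.range (m + 1),
      (m.choose k : ℝ) * (poch a k * poch (c + k) (m - k) * (-r) ^ k)
  · rw [Finset.mul_sum, Finset.mul_sum]
    refine Finset.sum_congr rfl fun k hk => ?_
    have hk' : k ≤ m := Nat.lt_succ_iff.mp (Finset.mem_range.mp hk)
    have h1 := poch_neg m k hk'
    have h2 := poch_add c k (m - k)
    rw [Nat.add_sub_cancel' hk'] at h2
    have h3 : poch (-(m : ℝ)) k = (-1) ^ k * (m.choose k * (k ! : ℝ)) := by
      have h4 : ((m.choose k * k ! * (m - k)! : ℕ) : ℝ) = m ! := by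
        rw [Nat.choose_mul_factorial_mul_factorial hk']
      have h5 : ((m - k)! : ℝ) ≠ 0 := by positivity
      apply mul_right_cancel₀ h5
      rw [h1, ← h4]
      push_cast
      ring
    have h6 := (poch_pos c hcpos k).ne'
    have h7 : (k ! : ℝ) ≠ 0 := by positivity
    rw [h3, h2, neg_pow r]
    field_simp
  · rw [← hk, Finset.mul_sum]
    refine Finset.sum_congr rfl fun k hk => ?_
    have hk' : k ≤ m := Nat.lt_succ_iff.mp (Finset.mem_range.mp hk)
    have h1 := poch_neg m k hk'
    have h2 := poch_neg (2 * m) k (by omega)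
    push_cast at h2
    have h3 := poch_nat m (m - k)
    rw [show m + (m - k) = 2 * m - k by omega] at h3
    have h4 : ((m.choose k * k ! * (m - k)! : ℕ) : ℝ) = m ! := by
      rw [Nat.choose_mul_factorial_mul_factorial hk']
    push_cast at h4
    have h5 : ((m - k)! : ℝ) ≠ 0 := by positivity
    have h6 : ((2 * m - k)! : ℝ) ≠ 0 := by positivity
    have h7 : (k ! : ℝ) ≠ 0 := by positivity
    have h8 : ((-1 : ℝ)) ^ k ≠ 0 := by simp
    have e1 : poch (-(m : ℝ)) k = (-1) ^ k * (m.choose k * (k ! : ℝ)) := by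
      apply mul_right_cancel₀ h5
      rw [h1, ← h4]
      ring
    have e2 : poch (-(2 * (m : ℝ))) k = (-1) ^ k * ((2 * m)! : ℕ) / ((2 * m - k)! : ℕ) := by
      rw [eq_div_iff h6, h2]
    rw [e1, e2, ← h3]
    rw [← h3] at h6
    field_simp
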